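/- Centered recursion for averages against polynomials (Corollary 2): for every two-variable real polynomial p and every integer n ≥ 3, ⟨(S_{2,n} − n/4)·p(S_{2,n}, n)⟩ = (n/4)·⟨p(S_{2,n}, n)⟩ − (n(n−2)/(2(2n−3)))·⟨p(S_{2,n−1}, n)⟩, where the first two expectations are over Ω_n with measure P_n and the third is over Ω_{n−1} with measure P_{n−1} (with n kept fixed in the second argument of p). -/

import Mathlib

open MeasureTheory ProbabilityTheory Filter
open scoped NNReal Topology

/-- Binary trees: every internal node has exactly two children. -/
inductive BinTree : Type
  | leaf : BinTree
  | node : BinTree → BinTree → BinTree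
  deriving DecidableEq

namespace BinTree

/-- The magnitude of a binary tree is its number of leaves. -/
def magnitude : BinTree → ℕ
  | leaf => 1
  | node l r => magnitude l + magnitude r

/-- The Horton–Strahler order of (the root of) a binary tree:
leaves have order 1; a node whose two children have distinct orders has the max of the two;
a node whose two children have equal order `r` has order `r + 1`. -/
def ord : BinTree → ℕ
  | leaf => 1
  | node l r => if ord l = ord r then ord l + 1 else max (ord l) (ord r)

/-- `branches k τ` is `S_{k,n}(τ)`, the number of Horton–Strahler branches of order `k`
in `τ`, i.e. the number of maximal connected paths of nodes of order `k`.  It counts the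
nodes of order `k` that head a branch: a new branch head of order `ord l + 1` is created
exactly at a node whose two children have equal order `ord l`, and every leaf heads an
order-1 branch. -/
def branches (k : ℕ) : BinTree → ℕ
  | leaf => if k = 1 then 1 else 0
  | node l r => branches k l + branches k r +
      (if ord l = ord r ∧ ord l + 1 = k then 1 else 0)

end BinTree

/-- `treesOf n` is the finite set `Ω_n` of binary trees of magnitude `n`. -/
def treesOf : ℕ → Finset BinTree
  | 0 => ∅
  | 1 => {BinTree.leaf}
  | (n+2) => (Finset.range (n+1)).attach.biUnion fun k =>
      ((treesOf (k.1+1)) ×ˢ (treesOf (n+1-k.1))).image fun p => BinTree.node p.1 p.2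
  decreasing_by
  · have := Finset.mem_range.mp k.2; omega
  · omega

/-- Expectation `⟨f⟩` under the uniform probability measure `P_n` on `Ω_n` (the random model). -/
noncomputable def expect (n : ℕ) (f : BinTree → ℝ) : ℝ :=
  (∑ τ ∈ treesOf n, f τ) / (treesOf n).card

namespace BinTree

theorem one_le_ord (τ : BinTree) : 1 ≤ ord τ := by
  induction τ with
  | leaf => simp [ord]
  | node l r hl hr => rw [ord]; split_ifs <;> omega

theorem ord_eq_one_iff (τ : BinTree) : ord τ = 1 ↔ τ = leaf := by
  cases τ with
  | leaf => simp [ord]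
  | node l r =>
    have hl := one_le_ord l
    have hr := one_le_ord r
    simp only [ord, reduceCtorEq, iff_false]
    split_ifs <;> omega

theorem branches_two_node (l r : BinTree) :
    branches 2 (node l r) =
      branches 2 l + branches 2 r + if l = leaf ∧ r = leaf then 1 else 0 := by
  simp only [branches]
  congr 1
  refine if_congr ?_ rfl rfl
  rw [← ord_eq_one_iff, ← ord_eq_one_iff]
  omega

end BinTree

section

open BinTree Polynomial Finset

theorem magnitude_of_mem_treesOf (n : ℕ) : ∀ τ ∈ treesOf n, magnitude τ = n := by
  induction n using Nat.strong_induction_on with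
  | _ n ih =>
    match n with
    | 0 => simp [treesOf]
    | 1 => simp [treesOf, magnitude]
    | n + 2 =>
      intro τ hτ
      rw [treesOf] at hτ
      simp only [mem_biUnion, mem_attach, true_and, mem_image, mem_product] at hτ
      obtain ⟨⟨k, hk⟩, ⟨l, r⟩, ⟨hl, hr⟩, rfl⟩ := hτ
      have hk' := mem_range.mp hk
      simp only at hl hr
      rw [magnitude, ih _ (by omega) l hl, ih _ (by omega) r hr]
      omega

theorem leaf_mem_treesOf_iff (n : ℕ) : leaf ∈ treesOf n ↔ n = 1 := by
  constructor
  · intro h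
    exact (magnitude_of_mem_treesOf n _ h).symm
  · rintro rfl
    simp [treesOf]

theorem sum_treesOf_add_two {M : Type*} [AddCommMonoid M] (n : ℕ) (f : BinTree → M) :
    ∑ τ ∈ treesOf (n + 2), f τ =
      ∑ x ∈ antidiagonal n, ∑ l ∈ treesOf (x.1 + 1), ∑ r ∈ treesOf (x.2 + 1), f (node l r) := by
  rw [treesOf, sum_biUnion]
  · rw [Nat.sum_antidiagonal_eq_sum_range_succ_mk,
      ← sum_attach (range n.succ)]
    refine sum_congr rfl fun k _ => ?_
    have hk := mem_range.mp k.2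
    rw [sum_image, sum_product]
    · rw [show n + 1 - k.1 = n - k.1 + 1 by omega]
    · rintro ⟨a, b⟩ _ ⟨c, d⟩ _ h
      simpa using h
  · intro k _ k' _ hne
    simp only [Function.onFun]
    rw [disjoint_left]
    intro τ h h'
    simp only [mem_image, mem_product] at h h'
    obtain ⟨⟨l, r⟩, ⟨hl, -⟩, rfl⟩ := h
    obtain ⟨⟨l', r'⟩, ⟨hl', -⟩, he⟩ := h'
    simp only [node.injEq] at he hl hl'
    rw [he.1] at hl'
    have h1 := magnitude_of_mem_treesOf _ _ hl
    have h2 := magnitude_of_mem_treesOf _ _ hl'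
    exact hne (Subtype.ext (by omega))

theorem card_treesOf_add_one (n : ℕ) : (treesOf (n + 1)).card = catalan n := by
  induction n using Nat.strong_induction_on with
  | _ n ih =>
    match n with
    | 0 => simp [treesOf]
    | n + 1 =>
      rw [catalan_succ', card_eq_sum_ones, sum_treesOf_add_two]
      refine sum_congr rfl fun x hx => ?_
      have hx' := mem_antidiagonal.mp hx
      simp only [sum_const, smul_eq_mul, mul_one]
      rw [ih x.1 (by omega), ih x.2 (by omega)]

theorem catalan_succ_ratio (n : ℕ) :
    (n + 2) * catalan (n + 1) = 2 * (2 * n + 1) * catalan n := by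
  have h0 := succ_mul_catalan_eq_centralBinom n
  have h1 := succ_mul_catalan_eq_centralBinom (n + 1)
  have h2 := Nat.succ_mul_centralBinom_succ n
  rw [← h0, ← h1] at h2
  apply Nat.eq_of_mul_eq_mul_left (Nat.succ_pos n)
  simp only [Nat.succ_eq_add_one] at *
  linarith

/-- Generating polynomial, by number of order-2 branches, of the trees with `n + 1` leaves. -/
noncomputable def branchPoly (n : ℕ) : ℝ[X] :=
  ∑ τ ∈ treesOf (n + 1), X ^ branches 2 τ

/-- Generating polynomial of the trees with `n + 1` leaves, each weighted by the number
`n + 1 - 2 * branches 2 τ` of its leaves whose sibling is not a leaf. -/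
noncomputable def weightedBranchPoly (n : ℕ) : ℝ[X] :=
  ∑ τ ∈ treesOf (n + 1), C ((n : ℝ) + 1 - 2 * branches 2 τ) * X ^ branches 2 τ

theorem branches_two_node_of_mem {n : ℕ} {x : ℕ × ℕ} (hx : x ∈ antidiagonal (n + 1))
    {l r : BinTree} (hl : l ∈ treesOf (x.1 + 1)) (hr : r ∈ treesOf (x.2 + 1)) :
    branches 2 (node l r) = branches 2 l + branches 2 r := by
  rw [branches_two_node, if_neg, add_zero]
  rintro ⟨rfl, rfl⟩
  rw [leaf_mem_treesOf_iff] at hl hr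
  have := mem_antidiagonal.mp hx
  omega

theorem branchPoly_add_two (n : ℕ) :
    branchPoly (n + 2) = ∑ x ∈ antidiagonal (n + 1), branchPoly x.1 * branchPoly x.2 := by
  rw [branchPoly, sum_treesOf_add_two]
  refine sum_congr rfl fun x hx => ?_
  rw [branchPoly, branchPoly, sum_mul_sum]
  refine sum_congr rfl fun l hl => sum_congr rfl fun r hr => ?_
  rw [branches_two_node_of_mem hx hl hr, pow_add]

theorem weightedBranchPoly_add_two (n : ℕ) :
    weightedBranchPoly (n + 2) = ∑ x ∈ antidiagonal (n + 1),
      (weightedBranchPoly x.1 * branchPoly x.2 + branchPoly x.1 * weightedBranchPoly x.2) := by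
  rw [weightedBranchPoly, sum_treesOf_add_two]
  refine sum_congr rfl fun x hx => ?_
  simp only [branchPoly, weightedBranchPoly, sum_mul_sum, ← sum_add_distrib]
  refine sum_congr rfl fun l hl => sum_congr rfl fun r hr => ?_
  rw [branches_two_node_of_mem hx hl hr, pow_add]
  have hx' : (x.1 : ℝ) + x.2 = n + 1 := by exact_mod_cast mem_antidiagonal.mp hx
  have hw : ((n + 2 : ℕ) : ℝ) + 1 - 2 * ((branches 2 l + branches 2 r : ℕ) : ℝ) =
      (x.1 + 1 - 2 * branches 2 l) + (x.2 + 1 - 2 * branches 2 r) := by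
    push_cast
    linarith
  rw [hw, C_add]
  ring

theorem weightedBranchPoly_zero : weightedBranchPoly 0 = 1 := by
  simp [weightedBranchPoly, treesOf, branches]

theorem weightedBranchPoly_one : weightedBranchPoly 1 = 0 := by
  rw [weightedBranchPoly, sum_treesOf_add_two]
  simp [treesOf, branches, ord, one_add_one_eq_two]

theorem sum_antidiagonal_fst_mul {R : Type*} [CommRing R] (a : ℕ → R) (n : ℕ) :
    2 * ∑ x ∈ antidiagonal n, (x.1 : R) * (a x.1 * a x.2) =
      n * ∑ x ∈ antidiagonal n, a x.1 * a x.2 := by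
  rw [two_mul]
  nth_rewrite 2 [← Nat.sum_antidiagonal_swap]
  rw [← sum_add_distrib, mul_sum]
  refine sum_congr rfl fun x hx => ?_
  rw [← mem_antidiagonal.mp hx]
  simp only [Prod.fst_swap, Prod.snd_swap]
  push_cast
  ring

theorem weightedBranchPoly_succ (n : ℕ) :
    weightedBranchPoly (n + 1) = 2 * n * branchPoly n := by
  induction n using Nat.strong_induction_on with
  | _ n ih =>
    match n with
    | 0 => simp [weightedBranchPoly_one]
    | n + 1 =>
      have hsymm : weightedBranchPoly (n + 2) =
          2 * ∑ x ∈ antidiagonal (n + 1), weightedBranchPoly x.1 * branchPoly x.2 := by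
        rw [weightedBranchPoly_add_two, sum_add_distrib, two_mul]
        congr 1
        rw [← Nat.sum_antidiagonal_swap]
        simp only [Prod.fst_swap, Prod.snd_swap, mul_comm]
      have hrec : ∑ x ∈ antidiagonal n, weightedBranchPoly (x.1 + 1) * branchPoly x.2 =
          n * ∑ x ∈ antidiagonal n, branchPoly x.1 * branchPoly x.2 := by
        rw [← sum_antidiagonal_fst_mul, mul_sum]
        refine sum_congr rfl fun x hx => ?_
        have hx' := mem_antidiagonal.mp hx
        rw [ih x.1 (by omega)]
        ring
      rw [hsymm, Nat.sum_antidiagonal_succ, hrec, weightedBranchPoly_zero]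
      match n with
      | 0 => simp
      | n + 1 =>
        rw [← branchPoly_add_two]
        push_cast
        ring

theorem sum_weighted_treesOf (n : ℕ) (g : ℕ → ℝ) :
    ∑ τ ∈ treesOf (n + 2), ((n : ℝ) + 2 - 2 * branches 2 τ) * g (branches 2 τ) =
      2 * n * ∑ τ ∈ treesOf (n + 1), g (branches 2 τ) := by
  have h := congrArg (Polynomial.lsum fun m => (g m) • (LinearMap.id : ℝ →ₗ[ℝ] ℝ))
    (weightedBranchPoly_succ n)
  have h2 : (2 * n * branchPoly n : ℝ[X]) = (2 * n : ℝ) • branchPoly n := by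
    rw [smul_eq_C_mul, C_mul, map_ofNat, map_natCast]
  rw [h2, map_smul, weightedBranchPoly, branchPoly, map_sum, map_sum] at h
  have hmono (k : ℕ) (a : ℝ) :
      (Polynomial.lsum fun m => (g m) • (LinearMap.id : ℝ →ₗ[ℝ] ℝ)) (monomial k a) = g k * a := by
    simp [lsum_apply, sum_monomial_index]
  simp only [X_pow_eq_monomial, C_mul_monomial, hmono, smul_eq_mul, mul_one] at h
  rw [← h]
  refine sum_congr rfl fun τ _ => ?_
  push_cast
  ring

theorem expect_centered_mul (m : ℕ) (g : ℕ → ℝ) :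
    _root_.expect (m + 2) (fun τ => ((branches 2 τ : ℝ) - ((m + 2 : ℕ) : ℝ) / 4) *
        g (branches 2 τ)) =
      ((m + 2 : ℕ) : ℝ) / 4 * _root_.expect (m + 2) (fun τ => g (branches 2 τ)) -
        ((m + 2 : ℕ) : ℝ) * (((m + 2 : ℕ) : ℝ) - 2) / (2 * (2 * ((m + 2 : ℕ) : ℝ) - 3)) *
          _root_.expect (m + 1) (fun τ => g (branches 2 τ)) := by
  have key := sum_weighted_treesOf m g
  have hcat : ((m : ℝ) + 2) * catalan (m + 1) = 2 * (2 * m + 1) * catalan m := by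
    exact_mod_cast catalan_succ_ratio m
  have hpos : (0 : ℝ) < catalan m := by
    have h := succ_mul_catalan_eq_centralBinom m
    have h' := Nat.centralBinom_pos m
    rw [← h] at h'
    exact_mod_cast Nat.pos_of_mul_pos_left h'
  have hm : (0 : ℝ) < 2 * m + 1 := by positivity
  have hcat' : (catalan (m + 1) : ℝ) = 2 * (2 * m + 1) * catalan m / (m + 2) := by
    rw [eq_div_iff (by positivity), ← hcat]
    ring
  have hsplit : ∑ τ ∈ treesOf (m + 2),
      ((branches 2 τ : ℝ) - ((m + 2 : ℕ) : ℝ) / 4) * g (branches 2 τ) =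
        ((m : ℝ) + 2) / 4 * ∑ τ ∈ treesOf (m + 2), g (branches 2 τ) -
          m * ∑ τ ∈ treesOf (m + 1), g (branches 2 τ) := by
    have h : (m : ℝ) * ∑ τ ∈ treesOf (m + 1), g (branches 2 τ) = 1 / 2 *
        ∑ τ ∈ treesOf (m + 2), ((m : ℝ) + 2 - 2 * branches 2 τ) * g (branches 2 τ) := by
      rw [key]
      ring
    rw [h, mul_sum, mul_sum, ← sum_sub_distrib]
    refine sum_congr rfl fun τ _ => ?_
    push_cast
    ring
  simp only [_root_.expect]
  rw [hsplit, card_treesOf_add_one, card_treesOf_add_one, hcat']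
  have hden : (2 * ((m + 2 : ℕ) : ℝ) - 3) = 2 * m + 1 := by
    push_cast
    ring
  rw [hden]
  push_cast
  field_simp
  ring

end

/-- Centered recursion for averages against polynomials (Corollary 2): for every two-variable
real polynomial `p` and every `n ≥ 3`,
`⟨(S_{2,n} − n/4) p(S_{2,n}, n)⟩ = (n/4)⟨p(S_{2,n}, n)⟩ − (n(n−2)/(2(2n−3)))⟨p(S_{2,n−1}, n)⟩`. -/
theorem centered_recursion_polynomial_averages (p : MvPolynomial (Fin 2) ℝ) (n : ℕ) (hn : 3 ≤ n) :
    expect n (fun τ => ((BinTree.branches 2 τ : ℝ) - (n : ℝ) / 4) *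
        MvPolynomial.eval ![(BinTree.branches 2 τ : ℝ), (n : ℝ)] p)
      = ((n : ℝ) / 4) *
          expect n (fun τ => MvPolynomial.eval ![(BinTree.branches 2 τ : ℝ), (n : ℝ)] p)
        - ((n : ℝ) * ((n : ℝ) - 2) / (2 * (2 * (n : ℝ) - 3))) *
            expect (n-1) (fun τ => MvPolynomial.eval ![(BinTree.branches 2 τ : ℝ), (n : ℝ)] p) := by
  obtain ⟨m, rfl⟩ : ∃ m, n = m + 2 := ⟨n - 2, by omega⟩
  exact expect_centered_mul m fun k => MvPolynomial.eval ![(k : ℝ), ((m + 2 : ℕ) : ℝ)] p
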